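/- Let μ be a log-concave probability measure on ℝ. Then for every x with q_μ(x) < 1/(2e), Λ*_μ(x) ≥ log(1 / (2 q_μ(x) log(1/(2 q_μ(x))))) − 1. -/

import Mathlib

open MeasureTheory Real Set Pointwise

/-- One-dimensional half-space depth: `q_μ(x) = min {μ(−∞,x], μ[x,∞)}`. -/
noncomputable def depth1 (μ : Measure ℝ) (x : ℝ) : ℝ :=
  min (μ (Set.Iic x)).toReal (μ (Set.Ici x)).toReal

/-- Cramér transform of a probability measure on `ℝ`. -/
noncomputable def cramer1 (μ : Measure ℝ) (x : ℝ) : ℝ :=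
  ⨆ t : {t : ℝ // Integrable (fun y => Real.exp (t * y)) μ},
    (x * t.1 - Real.log (∫ y, Real.exp (t.1 * y) ∂μ))

/-- A measure `μ` on `ℝ` is log-concave (à la Borell) if
`μ((1−λ)A + λB) ≥ μ(A)^{1−λ} μ(B)^λ` for all sets `A, B` and `λ ∈ (0,1)`. -/
def IsLogConcaveMeasure (μ : Measure ℝ) : Prop :=
  ∀ A B : Set ℝ, ∀ l ∈ Set.Ioo (0 : ℝ) 1,
    μ A ^ (1 - l) * μ B ^ l ≤ μ ((1 - l) • A + l • B)

open Filter Topology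

lemma exists_lt_lt_measureReal_Ici (μ : Measure ℝ) [IsProbabilityMeasure μ] {c : ℝ} (hc : c < 1)
    (x : ℝ) : ∃ y < x, c < μ.real (Ici y) := by
  have h : Tendsto (fun y => μ.real (Ici y)) atBot (𝓝 1) := by
    have := tendsto_measure_Ici_atBot μ
    rw [measure_univ] at this
    exact (ENNReal.tendsto_toReal ENNReal.one_ne_top).comp this
  obtain ⟨y, hy, hyx⟩ := ((h.eventually_const_lt hc).and (eventually_lt_atBot x)).exists
  exact ⟨y, hyx, hy⟩

namespace IsLogConcaveMeasure

lemma neg {μ : Measure ℝ} (hμ : IsLogConcaveMeasure μ) :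
    IsLogConcaveMeasure (μ.map (MeasurableEquiv.neg ℝ)) := by
  intro A B l hl
  simp only [MeasurableEquiv.map_apply]
  change μ (-A) ^ (1 - l) * μ (-B) ^ l ≤ μ (-((1 - l) • A + l • B))
  rw [neg_add, ← smul_set_neg, ← smul_set_neg]
  exact hμ _ _ l hl

variable {μ : Measure ℝ} [IsProbabilityMeasure μ]

lemma real_rpow_mul_le (hμ : IsLogConcaveMeasure μ) {A B C : Set ℝ} {l : ℝ} (hl : l ∈ Ioo (0 : ℝ) 1)
    (hC : (1 - l) • A + l • B ⊆ C) : μ.real A ^ (1 - l) * μ.real B ^ l ≤ μ.real C := by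
  simp only [measureReal_def, ENNReal.toReal_rpow, ← ENNReal.toReal_mul]
  exact ENNReal.toReal_mono (measure_ne_top _ _) ((hμ A B l hl).trans (measure_mono hC))

lemma log_tail_concave (hμ : IsLogConcaveMeasure μ) {y x w : ℝ} (hyx : y < x) (hxw : x < w)
    (hw : 0 < μ.real (Ici w)) :
    (w - x) * log (μ.real (Ici y)) + (x - y) * log (μ.real (Ici w)) ≤
      (w - y) * log (μ.real (Ici x)) := by
  have hwy : 0 < w - y := by linarith
  have hy : 0 < μ.real (Ici y) := hw.trans_le (measureReal_mono (Ici_subset_Ici.2 (by linarith)))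
  set l := (x - y) / (w - y) with hldef
  have hl : l ∈ Ioo (0 : ℝ) 1 :=
    ⟨div_pos (by linarith) hwy, (div_lt_one hwy).2 (by linarith)⟩
  have hlw : l * (w - y) = x - y := by rw [hldef]; field_simp
  have hsub : (1 - l) • Ici y + l • Ici w ⊆ Ici x := by
    rintro _ ⟨_, ⟨a, ha, rfl⟩, _, ⟨b, hb, rfl⟩, rfl⟩
    simp only [mem_Ici, smul_eq_mul] at *
    nlinarith [mul_le_mul_of_nonneg_left ha (sub_pos.2 hl.2).le,
      mul_le_mul_of_nonneg_left hb hl.1.le]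
  have h := log_le_log (by positivity) (hμ.real_rpow_mul_le hl hsub)
  rw [log_mul (by positivity) (by positivity), log_rpow hy, log_rpow hw] at h
  have h1 := mul_le_mul_of_nonneg_left h hwy.le
  have : (w - y) * ((1 - l) * log (μ.real (Ici y)) + l * log (μ.real (Ici w))) =
      (w - y - l * (w - y)) * log (μ.real (Ici y)) + l * (w - y) * log (μ.real (Ici w)) := by ring
  rw [this, hlw] at h1
  linarith

lemma measureReal_singleton_eq_zero (hμ : IsLogConcaveMeasure μ) {x : ℝ}
    (hx : μ.real (Ici x) < 1) : μ.real {x} = 0 := by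
  by_contra hne
  have hpos : 0 < μ.real {x} := lt_of_le_of_ne measureReal_nonneg (Ne.symm hne)
  obtain ⟨z, hzx, hz⟩ := exists_lt_lt_measureReal_Ici μ hx x
  have hB : 0 < μ.real (Ico z x) := by
    have : μ.real (Ici z) ≤ μ.real (Ico z x) + μ.real (Ici x) := by
      rw [← Ico_union_Ici_eq_Ici hzx.le]
      exact measureReal_union_le _ _
    linarith
  have hsub : ∀ l ∈ Ioo (0 : ℝ) 1, μ.real {x} ^ (1 - l) * μ.real (Ico z x) ^ l ≤
      μ.real (Ico (x - l * (x - z)) x) := by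
    intro l hl
    refine hμ.real_rpow_mul_le hl ?_
    rintro _ ⟨_, ⟨a, rfl, rfl⟩, _, ⟨b, hb, rfl⟩, rfl⟩
    simp only [mem_Ico, smul_eq_mul] at *
    constructor <;> nlinarith [hl.1]
  set u : ℕ → ℝ := fun n => 1 / ((n : ℝ) + 2)
  have hu : ∀ n, u n ∈ Ioo (0 : ℝ) 1 := fun n =>
    ⟨by positivity, by rw [div_lt_one (by positivity)]; linarith [(n.cast_nonneg : (0 : ℝ) ≤ n)]⟩
  have hu0 : Tendsto u atTop (𝓝 0) := by
    have := (tendsto_one_div_add_atTop_nhds_zero_nat (𝕜 := ℝ)).comp (tendsto_add_atTop_nat 1)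
    refine this.congr fun n => ?_
    simp only [u, Function.comp]
    push_cast
    ring_nf
  have hL : Tendsto (fun n => μ.real {x} ^ (1 - u n) * μ.real (Ico z x) ^ u n) atTop
      (𝓝 (μ.real {x})) := by
    have h1 := (tendsto_const_nhds (x := μ.real {x})).rpow (hu0.const_sub 1) (Or.inl hne)
    have h2 := (tendsto_const_nhds (x := μ.real (Ico z x))).rpow hu0 (Or.inl hB.ne')
    simpa using h1.mul h2
  have hR : Tendsto (fun n => μ.real (Ico (x - u n * (x - z)) x)) atTop (𝓝 0) := by
    have hI : ⋂ n, Ico (x - u n * (x - z)) x = ∅ := by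
      refine eq_empty_of_forall_notMem fun y hy => ?_
      rw [mem_iInter] at hy
      have h1 : Tendsto (fun n => x - u n * (x - z)) atTop (𝓝 x) := by
        simpa using (hu0.mul_const (x - z)).const_sub x
      exact (hy 0).2.not_ge (le_of_tendsto' h1 fun n => (hy n).1)
    have hanti : Antitone fun n => Ico (x - u n * (x - z)) x := by
      intro m n hmn
      refine Ico_subset_Ico_left ?_
      have : u n ≤ u m := one_div_le_one_div_of_le (by positivity) (by gcongr)
      nlinarith
    have := tendsto_measure_iInter_atTop (μ := μ)
      (fun n => (measurableSet_Ico (a := x - u n * (x - z)) (b := x)).nullMeasurableSet) hanti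
      ⟨0, measure_ne_top _ _⟩
    rw [hI, measure_empty] at this
    exact (ENNReal.tendsto_toReal ENNReal.zero_ne_top).comp this
  exact hpos.not_ge (le_of_tendsto_of_tendsto' hL hR fun n => hsub _ (hu n))

lemma exists_gt_tail_pos (hμ : IsLogConcaveMeasure μ) {x : ℝ} (h0 : 0 < μ.real (Ici x))
    (h1 : μ.real (Ici x) < 1) : ∃ w > x, 0 < μ.real (Ici w) := by
  by_contra! h
  have hIoi : μ (Ioi x) = 0 := by
    have : Ioi x = ⋃ n : ℕ, Ici (x + 1 / ((n : ℝ) + 1)) := by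
      ext y
      simp only [mem_Ioi, mem_iUnion, mem_Ici]
      constructor
      · intro hy
        obtain ⟨n, hn⟩ := exists_nat_one_div_lt (sub_pos.2 hy)
        exact ⟨n, by linarith⟩
      · rintro ⟨n, hn⟩
        have : 0 < 1 / ((n : ℝ) + 1) := by positivity
        linarith
    rw [this, measure_iUnion_null_iff]
    intro n
    have hn : 0 < 1 / ((n : ℝ) + 1) := by positivity
    exact (measureReal_eq_zero_iff).1 (le_antisymm (h _ (by linarith)) measureReal_nonneg)
  have hle : μ.real (Ici x) ≤ μ.real {x} + μ.real (Ioi x) := by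
    rw [← Ioi_union_left, union_comm]
    exact measureReal_union_le _ _
  rw [hμ.measureReal_singleton_eq_zero h1, measureReal_def, measureReal_def, hIoi] at hle
  simp only [ENNReal.toReal_zero, add_zero] at hle
  exact hle.not_gt h0

lemma exists_tail_le_exp (hμ : IsLogConcaveMeasure μ) {x : ℝ} (h0 : 0 < μ.real (Ici x))
    (h1 : μ.real (Ici x) < 1) :
    ∃ a > 0, ∀ y, μ.real (Ici y) ≤ μ.real (Ici x) * exp (-a * (y - x)) := by
  set g : ℝ → ℝ := fun y => log (μ.real (Ici y)) with hg
  set S : Set ℝ := (fun y => (g y - g x) / (x - y)) '' Iio x with hS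
  have hslope : ∀ w > x, 0 < μ.real (Ici w) → ∀ s ∈ S, s ≤ (g x - g w) / (w - x) := by
    rintro w hw hw0 _ ⟨y, hy, rfl⟩
    have hy : y < x := hy
    have := hμ.log_tail_concave hy hw hw0
    rw [div_le_div_iff₀ (by linarith) (by linarith)]
    simp only [hg]
    nlinarith
  obtain ⟨w, hw, hw0⟩ := hμ.exists_gt_tail_pos h0 h1
  have hbdd : BddAbove S := ⟨_, hslope w hw hw0⟩
  have hle : ∀ y < x, (g y - g x) / (x - y) ≤ sSup S := fun y hy =>
    le_csSup hbdd ⟨y, hy, rfl⟩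
  obtain ⟨z, hzx, hz⟩ := exists_lt_lt_measureReal_Ici μ h1 x
  refine ⟨sSup S, ?_, fun y => ?_⟩
  · refine lt_of_lt_of_le (div_pos ?_ (sub_pos.2 hzx)) (hle z hzx)
    exact sub_pos.2 (log_lt_log h0 hz)
  rcases eq_or_lt_of_le (measureReal_nonneg (μ := μ) (s := Ici y)) with hy0 | hy0
  · rw [← hy0]; positivity
  rw [← log_le_log_iff hy0 (by positivity), log_mul h0.ne' (exp_pos _).ne', log_exp]
  change g y ≤ g x + _
  rcases lt_trichotomy y x with hy | rfl | hy
  · have := (div_le_iff₀ (sub_pos.2 hy)).1 (hle y hy)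
    linarith
  · simp
  · have : sSup S ≤ (g x - g y) / (y - x) :=
      csSup_le ⟨_, z, hzx, rfl⟩ (hslope y hy hy0)
    rw [le_div_iff₀ (sub_pos.2 hy)] at this
    linarith

end IsLogConcaveMeasure

lemma lintegral_min_one_mul_rpow_le {q p : ℝ} (hq : 0 < q) (hp : 1 < p) :
    ∫⁻ u in Ioi (0 : ℝ), ENNReal.ofReal (min 1 (q * u ^ (-p))) ≤
      ENNReal.ofReal (q ^ (1 / p) * (p / (p - 1))) := by
  set c := q ^ (1 / p) with hc
  have hc0 : 0 < c := by positivity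
  have hcp : c ^ p = q := by
    rw [hc, ← rpow_mul hq.le, one_div_mul_cancel (by positivity), rpow_one]
  rw [← Ioc_union_Ioi_eq_Ioi hc0.le]
  refine (lintegral_union_le _ _ _).trans ?_
  have h1 : ∫⁻ u in Ioc 0 c, ENNReal.ofReal (min 1 (q * u ^ (-p))) ≤ ENNReal.ofReal c := by
    calc _ ≤ ∫⁻ _ in Ioc 0 c, 1 := by
          gcongr with u
          exact ENNReal.ofReal_le_one.2 (min_le_left _ _)
      _ = _ := by simp
  have hInt := (integrableOn_Ioi_rpow_of_lt (a := -p) (by linarith) hc0).const_mul q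
  have h2 : ∫⁻ u in Ioi c, ENNReal.ofReal (min 1 (q * u ^ (-p))) ≤
      ENNReal.ofReal (c / (p - 1)) := by
    calc _ ≤ ∫⁻ u in Ioi c, ENNReal.ofReal (q * u ^ (-p)) := by
          gcongr with u
          exact min_le_right _ _
      _ = ENNReal.ofReal (∫ u in Ioi c, q * u ^ (-p)) := by
          refine (ofReal_integral_eq_lintegral_ofReal hInt ?_).symm
          refine (ae_restrict_iff' measurableSet_Ioi).2 (ae_of_all _ fun u hu => ?_)
          have : 0 < u := hc0.trans hu
          simp only [Pi.zero_apply]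
          positivity
      _ = _ := by
          rw [integral_const_mul, integral_Ioi_rpow_of_lt (by linarith) hc0, rpow_add hc0,
            rpow_neg hc0.le, hcp, rpow_one]
          congr 1
          have : p - 1 ≠ 0 := by linarith
          have h' : -p + 1 ≠ 0 := by linarith
          field_simp
          ring
  refine (add_le_add h1 h2).trans ?_
  rw [← ENNReal.ofReal_add hc0.le (div_nonneg hc0.le (by linarith))]
  refine ENNReal.ofReal_le_ofReal (le_of_eq ?_)
  have : p - 1 ≠ 0 := by linarith
  field_simp
  ring

lemma lintegral_exp_le_of_tail_le {μ : Measure ℝ} [IsProbabilityMeasure μ] {x q a ε : ℝ}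
    (hq : 0 < q) (ha : 0 < a) (hε : ε ∈ Ioo (0 : ℝ) 1)
    (h : ∀ y, μ.real (Ici y) ≤ q * exp (-a * (y - x))) :
    ∫⁻ y, ENNReal.ofReal (exp ((1 - ε) * a * (y - x))) ∂μ ≤ ENNReal.ofReal (q ^ (1 - ε) / ε) := by
  have hε1 : 0 < 1 - ε := sub_pos.2 hε.2
  have ht : 0 < (1 - ε) * a := by positivity
  rw [lintegral_eq_lintegral_meas_le μ (ae_of_all _ fun y => (exp_pos _).le)
    (by fun_prop)]
  have hp : 1 < 1 / (1 - ε) := by rw [lt_div_iff₀ hε1]; linarith [hε.1]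
  have hmain := lintegral_min_one_mul_rpow_le hq hp
  have hval : q ^ (1 / (1 / (1 - ε))) * (1 / (1 - ε) / (1 / (1 - ε) - 1)) = q ^ (1 - ε) / ε := by
    have := hε.1.ne'
    have h' : 1 / (1 - ε) - 1 = ε / (1 - ε) := by field_simp; ring
    rw [one_div_one_div, h']
    field_simp
  rw [hval] at hmain
  refine le_trans (setLIntegral_mono' measurableSet_Ioi fun u hu => ?_) hmain
  have hu : 0 < u := hu
  have hset : {y | u ≤ exp ((1 - ε) * a * (y - x))} = Ici (x + log u / ((1 - ε) * a)) := by
    ext y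
    rw [mem_ofPred_eq, mem_Ici, ← log_le_iff_le_exp hu, ← le_sub_iff_add_le', div_le_iff₀' ht]
  rw [hset, ← ofReal_measureReal]
  refine ENNReal.ofReal_le_ofReal (le_min measureReal_le_one ((h _).trans_eq ?_))
  rw [rpow_def_of_pos hu]
  congr 2
  field_simp
  ring

/-- Lower bound for one term of the Cramér transform in terms of the right tail. -/
lemma IsLogConcaveMeasure.exists_le_sub_log_integral_exp {μ : Measure ℝ} [IsProbabilityMeasure μ]
    (hμ : IsLogConcaveMeasure μ) {x ε : ℝ} (h0 : 0 < μ.real (Ici x)) (h1 : μ.real (Ici x) < 1)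
    (hε : ε ∈ Ioo (0 : ℝ) 1) :
    ∃ t, Integrable (fun y => exp (t * y)) μ ∧
      (1 - ε) * log (1 / μ.real (Ici x)) + log ε ≤ x * t - log (∫ y, exp (t * y) ∂μ) := by
  obtain ⟨a, ha, h⟩ := hμ.exists_tail_le_exp h0 h1
  have hlin := lintegral_exp_le_of_tail_le h0 ha hε h
  set q := μ.real (Ici x)
  have hε0 := hε.1
  have hInt : Integrable (fun y => exp ((1 - ε) * a * (y - x))) μ :=
    lintegral_ofReal_ne_top_iff_integrable (by fun_prop) (ae_of_all _ fun y => (exp_pos _).le)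
      |>.1 (hlin.trans_lt ENNReal.ofReal_lt_top).ne
  have hI : ∫ y, exp ((1 - ε) * a * (y - x)) ∂μ ≤ q ^ (1 - ε) / ε := by
    rw [integral_eq_lintegral_of_nonneg_ae (ae_of_all _ fun y => (exp_pos _).le) (by fun_prop)]
    exact ENNReal.toReal_le_of_le_ofReal (by positivity) hlin
  have heq : (fun y => exp ((1 - ε) * a * y)) =
      fun y => exp ((1 - ε) * a * x) * exp ((1 - ε) * a * (y - x)) := by
    ext y
    rw [← exp_add]
    ring_nf
  refine ⟨(1 - ε) * a, heq ▸ hInt.const_mul _, ?_⟩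
  have hpos := integral_exp_pos hInt
  rw [heq, integral_const_mul, log_mul (exp_pos _).ne' hpos.ne', log_exp]
  have := log_le_log hpos hI
  rw [log_div (by positivity) hε0.ne', log_rpow h0] at this
  rw [one_div, log_inv]
  linarith

lemma integral_exp_ge_mul_measureReal {μ : Measure ℝ} [IsProbabilityMeasure μ] {x t : ℝ}
    {s : Set ℝ} (hs : MeasurableSet s) (hst : ∀ y ∈ s, t * x ≤ t * y)
    (ht : Integrable (fun y => exp (t * y)) μ) :
    exp (t * x) * μ.real s ≤ ∫ y, exp (t * y) ∂μ := by
  calc exp (t * x) * μ.real s = ∫ _ in s, exp (t * x) ∂μ := by simp [mul_comm]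
    _ ≤ ∫ y in s, exp (t * y) ∂μ :=
        setIntegral_mono_on (integrable_const _).integrableOn ht.integrableOn hs
          fun y hy => exp_le_exp.2 (hst y hy)
    _ ≤ _ := setIntegral_le_integral ht (ae_of_all _ fun y => (exp_pos _).le)

lemma bddAbove_cramer1 {μ : Measure ℝ} [IsProbabilityMeasure μ] {x : ℝ} (hx : 0 < depth1 μ x) :
    BddAbove (range fun t : {t : ℝ // Integrable (fun y => exp (t * y)) μ} =>
      x * t.1 - log (∫ y, exp (t.1 * y) ∂μ)) := by
  refine ⟨-log (depth1 μ x), ?_⟩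
  rintro _ ⟨⟨t, ht⟩, rfl⟩
  have key : exp (t * x) * depth1 μ x ≤ ∫ y, exp (t * y) ∂μ := by
    rcases le_total 0 t with h | h
    · refine le_trans ?_ (integral_exp_ge_mul_measureReal (x := x) (measurableSet_Ici (a := x))
        (fun y hy => mul_le_mul_of_nonneg_left hy h) ht)
      gcongr
      exact min_le_right _ _
    · refine le_trans ?_ (integral_exp_ge_mul_measureReal (x := x) (measurableSet_Iic (a := x))
        (fun y hy => mul_le_mul_of_nonpos_left hy h) ht)
      gcongr
      exact min_le_left _ _
  have := log_le_log (by positivity) key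
  rw [log_mul (exp_pos _).ne' hx.ne', log_exp] at this
  simp only
  linarith

lemma cramer1_nonneg (μ : Measure ℝ) [IsProbabilityMeasure μ] (x : ℝ) : 0 ≤ cramer1 μ x := by
  by_cases hb : BddAbove (range fun t : {t : ℝ // Integrable (fun y => exp (t * y)) μ} =>
      x * t.1 - log (∫ y, exp (t.1 * y) ∂μ))
  · refine (le_of_eq ?_).trans (le_ciSup hb ⟨0, by simp⟩)
    simp
  · rw [cramer1, iSup, Real.sSup_of_not_bddAbove hb]

/-- The bound `Λ*_μ(x) ≥ (1 - ε) log (1 / q_μ(x)) + log ε` for log-concave `μ`. -/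
lemma IsLogConcaveMeasure.le_cramer1 {μ : Measure ℝ} [IsProbabilityMeasure μ]
    (hμ : IsLogConcaveMeasure μ) {x ε : ℝ} (h0 : 0 < depth1 μ x) (h1 : depth1 μ x < 1)
    (hε : ε ∈ Ioo (0 : ℝ) 1) :
    (1 - ε) * log (1 / depth1 μ x) + log ε ≤ cramer1 μ x := by
  suffices ∃ t, Integrable (fun y => exp (t * y)) μ ∧
      (1 - ε) * log (1 / depth1 μ x) + log ε ≤ x * t - log (∫ y, exp (t * y) ∂μ) by
    obtain ⟨t, ht, hle⟩ := this
    exact hle.trans (le_ciSup (bddAbove_cramer1 h0) ⟨t, ht⟩)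
  rcases min_choice (μ (Iic x)).toReal (μ (Ici x)).toReal with h | h
  · have hq : (μ.map (MeasurableEquiv.neg ℝ)).real (Ici (-x)) = depth1 μ x := by
      rw [depth1, h, measureReal_def, MeasurableEquiv.map_apply]
      simp
    have : IsProbabilityMeasure (μ.map (MeasurableEquiv.neg ℝ)) :=
      Measure.isProbabilityMeasure_map (MeasurableEquiv.neg ℝ).measurable.aemeasurable
    obtain ⟨t, ht, hle⟩ := hμ.neg.exists_le_sub_log_integral_exp (x := -x)
      (by rwa [hq]) (by rwa [hq]) hε
    rw [hq, integral_map_equiv] at hle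
    rw [integrable_map_equiv] at ht
    refine ⟨-t, by simpa [Function.comp_def] using ht, ?_⟩
    simpa using hle
  · have hq : μ.real (Ici x) = depth1 μ x := by rw [depth1, h, measureReal_def]
    rw [← hq] at h0 h1 ⊢
    exact hμ.exists_le_sub_log_integral_exp h0 h1 hε

/-- Let `μ` be a log-concave probability measure on `ℝ`. Then for every `x` with
`q_μ(x) < 1/(2e)`, `Λ*_μ(x) ≥ log (1 / (2 q_μ(x) log(1/(2 q_μ(x))))) − 1`. -/
theorem cramer_ge_optimized (μ : Measure ℝ) [IsProbabilityMeasure μ]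
    (hμ : IsLogConcaveMeasure μ) :
    ∀ x : ℝ, depth1 μ x < 1 / (2 * Real.exp 1) →
      Real.log (1 / (2 * depth1 μ x * Real.log (1 / (2 * depth1 μ x)))) - 1 ≤
        cramer1 μ x := by
  intro x hx
  have hnonneg : 0 ≤ depth1 μ x := le_min ENNReal.toReal_nonneg ENNReal.toReal_nonneg
  rcases hnonneg.eq_or_lt with h0 | h0
  · rw [← h0]
    simpa using (by norm_num : (-1 : ℝ) ≤ 0).trans (cramer1_nonneg μ x)
  set q := depth1 μ x with hq
  set L := log (1 / (2 * q)) with hL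
  have hqe : exp 1 < 1 / (2 * q) := by
    rw [lt_div_iff₀ (by positivity)] at hx ⊢
    linarith
  have hL1 : 1 < L := (lt_log_iff_exp_lt (by positivity)).2 hqe
  have hL0 : 0 < L := by linarith
  have hq1 : q < 1 := by
    rw [lt_div_iff₀ (by positivity)] at hqe
    nlinarith [add_one_le_exp (1 : ℝ)]
  have hmain := hμ.le_cramer1 h0 hq1 (ε := 1 / L) ⟨by positivity, (div_lt_one hL0).2 hL1⟩
  have hLq : log (1 / q) = L + log 2 := by
    rw [hL, one_div, one_div, log_inv, log_inv, log_mul two_ne_zero h0.ne']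
    ring
  have hlhs : log (1 / (2 * q * L)) = L - log L := by
    rw [← div_div, log_div (by positivity) hL0.ne']
  have hdiv : log 2 / L ≤ log 2 := div_le_self (log_nonneg one_le_two) hL1.le
  rw [← hq, hLq, one_div, log_inv] at hmain
  have hexp : (1 - L⁻¹) * (L + log 2) = L + log 2 - 1 - log 2 / L := by
    field_simp
    ring
  rw [hlhs]
  linarith
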